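/- arXiv:1009.1585 — 7 statements merged into one kernel-verified Lean document; each statement's English description precedes it below -/
import Mathlib

section
/- Let x ∈ X with T(x) < ∞ and suppose x ∉ Ω_r for some r > 0, where Ω_r is the r-enlargement of the target. Then T(x) = r + T_{Ω_r}(x), where T_{Ω_r} denotes the minimal time function with the same dynamics F but with target set Ω_r. -/
open Set Filter Topology Pointwise
open scoped ENNReal

variable {X : Type*}

/-- Minimal time function `T(x) = inf{t ≥ 0 : Ω ∩ (x + tF) ≠ ∅}`, with `inf ∅ = ∞`. -/
noncomputable def mtime [NormedAddCommGroup X] [NormedSpace ℝ X]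
    (Ω F : Set X) (x : X) : ℝ≥0∞ :=
  ⨅ (t : ℝ) (_ : 0 ≤ t ∧ ∃ q ∈ F, x + t • q ∈ Ω), ENNReal.ofReal t

/-- Minkowski gauge `ρ_F(u) = inf{t ≥ 0 : u ∈ tF}`, with `inf ∅ = ∞`. -/
noncomputable def mgauge [NormedAddCommGroup X] [NormedSpace ℝ X]
    (F : Set X) (u : X) : ℝ≥0∞ :=
  ⨅ (t : ℝ) (_ : 0 ≤ t ∧ ∃ q ∈ F, u = t • q), ENNReal.ofReal t

/-- Enlargement `Ω_r = {x : T(x) ≤ r}` of the target set. -/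
noncomputable def enl [NormedAddCommGroup X] [NormedSpace ℝ X]
    (Ω F : Set X) (r : ℝ) : Set X :=
  {x | mtime Ω F x ≤ ENNReal.ofReal r}

/-- Generalized (minimal time) projection `Π(x) = (x + T(x)·F) ∩ Ω`. -/
noncomputable def mproj [NormedAddCommGroup X] [NormedSpace ℝ X]
    (Ω F : Set X) (x : X) : Set X :=
  {w | w ∈ Ω ∧ ∃ q ∈ F, w = x + (mtime Ω F x).toReal • q}

/-- Support function `σ_F(x*) = sup_{q ∈ F} ⟨x*, q⟩`. -/
noncomputable def suppFn [NormedAddCommGroup X] [NormedSpace ℝ X]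
    (F : Set X) (p : X →L[ℝ] ℝ) : ℝ :=
  sSup ((fun q => p q) '' F)

/-- Dynamics bound `‖F‖ = sup{‖q‖ : q ∈ F}`. -/
noncomputable def dynBound [NormedAddCommGroup X] (F : Set X) : ℝ :=
  sSup ((fun q => ‖q‖) '' F)

/-- Fréchet `ε`-subdifferential of `φ` at `xb`:
`liminf_{x→xb} (φ(x) − φ(xb) − ⟨x*, x−xb⟩)/‖x−xb‖ ≥ −ε`. -/
def fsub [NormedAddCommGroup X] [NormedSpace ℝ X]
    (φ : X → ℝ≥0∞) (ε : ℝ) (xb : X) : Set (X →L[ℝ] ℝ) :=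
  {p | ∀ γ > (0:ℝ), ∃ δ > (0:ℝ), ∀ x, ‖x - xb‖ < δ →
    ENNReal.ofReal ((φ xb).toReal + p (x - xb) - (ε + γ) * ‖x - xb‖) ≤ φ x}

/-- Set of `ε`-normals to `Θ` at `xb ∈ Θ`. -/
def enormal [NormedAddCommGroup X] [NormedSpace ℝ X]
    (Θ : Set X) (ε : ℝ) (xb : X) : Set (X →L[ℝ] ℝ) :=
  {p | ∀ γ > (0:ℝ), ∃ δ > (0:ℝ), ∀ x ∈ Θ, ‖x - xb‖ < δ →
    p (x - xb) ≤ (ε + γ) * ‖x - xb‖}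

/-- Basic (limiting/Mordukhovich) normal cone. -/
def bnormal [NormedAddCommGroup X] [NormedSpace ℝ X]
    (Θ : Set X) (xb : X) : Set (X →L[ℝ] ℝ) :=
  {p | ∃ (ε : ℕ → ℝ) (x : ℕ → X) (ps : ℕ → X →L[ℝ] ℝ),
    (∀ k, 0 ≤ ε k) ∧ Tendsto ε atTop (𝓝 0) ∧
    (∀ k, x k ∈ Θ) ∧ Tendsto x atTop (𝓝 xb) ∧
    (∀ k, ps k ∈ enormal Θ (ε k) (x k)) ∧
    (∀ v, Tendsto (fun k => ps k v) atTop (𝓝 (p v)))}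

/-- Basic (limiting/Mordukhovich) subdifferential. -/
def bsub [NormedAddCommGroup X] [NormedSpace ℝ X]
    (φ : X → ℝ≥0∞) (xb : X) : Set (X →L[ℝ] ℝ) :=
  {p | ∃ (ε : ℕ → ℝ) (x : ℕ → X) (ps : ℕ → X →L[ℝ] ℝ),
    (∀ k, 0 ≤ ε k) ∧ Tendsto ε atTop (𝓝 0) ∧
    Tendsto x atTop (𝓝 xb) ∧
    Tendsto (fun k => φ (x k)) atTop (𝓝 (φ xb)) ∧
    (∀ k, ps k ∈ fsub φ (ε k) (x k)) ∧
    (∀ v, Tendsto (fun k => ps k v) atTop (𝓝 (p v)))}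

/-- Singular (Mordukhovich) subdifferential. -/
def ssub [NormedAddCommGroup X] [NormedSpace ℝ X]
    (φ : X → ℝ≥0∞) (xb : X) : Set (X →L[ℝ] ℝ) :=
  {p | ∃ (ε lam : ℕ → ℝ) (x : ℕ → X) (ps : ℕ → X →L[ℝ] ℝ),
    (∀ k, 0 ≤ ε k) ∧ Tendsto ε atTop (𝓝 0) ∧
    (∀ k, 0 < lam k) ∧ Tendsto lam atTop (𝓝 0) ∧
    Tendsto x atTop (𝓝 xb) ∧
    Tendsto (fun k => φ (x k)) atTop (𝓝 (φ xb)) ∧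
    (∀ k, ps k ∈ fsub φ (ε k) (x k)) ∧
    (∀ v, Tendsto (fun k => lam k * ps k v) atTop (𝓝 (p v)))}

/-- Subdifferential of convex analysis (for `ℝ≥0∞`-valued convex functions,
finite at the reference point). -/
def csub [NormedAddCommGroup X] [NormedSpace ℝ X]
    (φ : X → ℝ≥0∞) (xb : X) : Set (X →L[ℝ] ℝ) :=
  {p | ∀ x, ENNReal.ofReal (p (x - xb) + (φ xb).toReal) ≤ φ x}

/-- Normal cone of convex analysis. -/
def cnormal [NormedAddCommGroup X] [NormedSpace ℝ X]
    (Θ : Set X) (xb : X) : Set (X →L[ℝ] ℝ) :=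
  {p | ∀ x ∈ Θ, p (x - xb) ≤ 0}

theorem mtime_le_ofReal [NormedAddCommGroup X] [NormedSpace ℝ X] {Ω F : Set X} {x q : X} {t : ℝ}
    (ht : 0 ≤ t) (hq : q ∈ F) (h : x + t • q ∈ Ω) : mtime Ω F x ≤ ENNReal.ofReal t :=
  iInf₂_le t ⟨ht, q, hq, h⟩

/-- Moving along `F` for time `t` decreases the minimal time by at most `t`. -/
theorem mtime_le_ofReal_add_mtime [NormedAddCommGroup X] [NormedSpace ℝ X] {Ω F : Set X}
    (hF : Convex ℝ F) {x q : X} {t : ℝ} (ht : 0 ≤ t) (hq : q ∈ F) :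
    mtime Ω F x ≤ ENNReal.ofReal t + mtime Ω F (x + t • q) := by
  conv_rhs => rw [mtime]
  simp only [ENNReal.add_iInf]
  refine le_iInf₂ fun s hs => ?_
  obtain ⟨hs, p, hp, hmem⟩ := hs
  obtain ⟨w, hw, hsum⟩ : t • q + s • p ∈ (t + s) • F := by
    rw [hF.add_smul ht hs]
    exact add_mem_add (smul_mem_smul_set hq) (smul_mem_smul_set hp)
  rw [← ENNReal.ofReal_add ht hs]
  refine mtime_le_ofReal (add_nonneg ht hs) hw ?_
  have hsum : (t + s) • w = t • q + s • p := hsum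
  rwa [hsum, ← add_assoc]

/-- Proposition 3.1: minimal time functions for enlargements of target sets:
if `x ∉ Ω_r` and `T(x) < ∞`, then `T(x) = r + T_{Ω_r}(x)` for all `r > 0`. -/
theorem mtime_enl_add [NormedAddCommGroup X] [NormedSpace ℝ X] [CompleteSpace X]
    (Ω F : Set X) (hΩne : Ω.Nonempty) (hΩcl : IsClosed Ω)
    (hFne : F.Nonempty) (hFcl : IsClosed F) (hFbd : Bornology.IsBounded F)
    (hFcv : Convex ℝ F)
    (r : ℝ) (hr : 0 < r) (x : X) (hx : x ∉ enl Ω F r) (hfin : mtime Ω F x < ⊤) :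
    mtime Ω F x = ENNReal.ofReal r + mtime (enl Ω F r) F x := by
  apply le_antisymm
  · conv_rhs => rw [mtime]
    simp only [ENNReal.add_iInf]
    refine le_iInf₂ fun t ht => ?_
    obtain ⟨ht, q, hq, hmem⟩ := ht
    rw [add_comm]
    exact (mtime_le_ofReal_add_mtime hFcv ht hq).trans (add_le_add_right hmem _)
  · conv_rhs => rw [mtime]
    refine le_iInf₂ fun t ht => ?_
    obtain ⟨ht, q, hq, hmem⟩ := ht
    have hrt : r ≤ t := by
      by_contra! h
      exact hx ((mtime_le_ofReal ht hq hmem).trans (ENNReal.ofReal_le_ofReal h.le))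
    have henl : x + (t - r) • q ∈ enl Ω F r := by
      refine mtime_le_ofReal hr.le hq ?_
      rwa [add_assoc, ← add_smul, sub_add_cancel]
    calc ENNReal.ofReal r + mtime (enl Ω F r) F x
        ≤ ENNReal.ofReal r + ENNReal.ofReal (t - r) := by
          gcongr
          exact mtime_le_ofReal (sub_nonneg.2 hrt) hq henl
      _ = ENNReal.ofReal t := by
          rw [← ENNReal.ofReal_add hr.le (sub_nonneg.2 hrt), add_sub_cancel]
end

section
/- Suppose that either (a) X is finite-dimensional, or (b) X is reflexive (the canonical embedding of X into its double dual is surjective) and the target set Ω is convex. Then the minimal time function T is lower semicontinuous, i.e., every level set {x ∈ X : T(x) ≤ α}, α ∈ ℝ, is closed. -/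
open Set Filter Topology Pointwise
open scoped ENNReal

variable {X : Type*}

/-- The set of points from which a closed set `Ω` can be reached in time `t ∈ [0, β]` along
a compact set `F` of directions is closed. -/
theorem isClosed_setOf_exists_add_smul_mem {E : Type*} [TopologicalSpace E] [AddCommGroup E]
    [Module ℝ E] [ContinuousAdd E] [ContinuousSMul ℝ E] {Ω F : Set E}
    (hΩ : IsClosed Ω) (hF : IsCompact F) (β : ℝ) :
    IsClosed {x : E | ∃ t ∈ Icc 0 β, ∃ q ∈ F, x + t • q ∈ Ω} := by
  have : CompactSpace F := isCompact_iff_compactSpace.mp hF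
  have hC : IsClosed {p : E × (Icc (0 : ℝ) β × F) | p.1 + (p.2.1 : ℝ) • (p.2.2 : E) ∈ Ω} :=
    hΩ.preimage (by fun_prop)
  convert isClosedMap_fst_of_compactSpace _ hC using 1
  ext x
  simp only [mem_ofPred_eq, mem_image, Prod.exists, Subtype.exists, exists_prop,
    exists_and_right, exists_eq_right]

/-- In a reflexive space, closed bounded convex sets are weakly compact. -/
theorem Convex.isCompact_toWeakSpace_image [NormedAddCommGroup X] [NormedSpace ℝ X]
    (hX : Function.Surjective (NormedSpace.inclusionInDoubleDual ℝ X)) {F : Set X}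
    (hFcv : Convex ℝ F) (hFcl : IsClosed F) (hFbd : Bornology.IsBounded F) :
    IsCompact (toWeakSpace ℝ X '' F) := by
  have hsurj : range (NormedSpace.inclusionInDoubleDualWeak ℝ X) = univ :=
    Function.Surjective.range_eq hX
  have h := NormedSpace.isCompact_closure_of_isBounded (𝕜 := ℝ) (X := X)
    (S := toWeakSpace ℝ X '' F) (by rwa [preimage_image_eq _ (toWeakSpace ℝ X).injective])
    (hsurj ▸ subset_univ _)
  rwa [← hFcv.toWeakSpace_closure ℝ, hFcl.closure_eq] at h

/-- Sublevel sets of the minimal time function in terms of reachability within larger times. -/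
theorem setOf_mtime_le_ofReal [NormedAddCommGroup X] [NormedSpace ℝ X] (Ω F : Set X) (α : ℝ) :
    {x : X | mtime Ω F x ≤ ENNReal.ofReal α} =
      ⋂ β ∈ Ioi (max α 0), {x : X | ∃ t ∈ Icc 0 β, ∃ q ∈ F, x + t • q ∈ Ω} := by
  ext x
  simp only [mem_ofPred_eq, mem_iInter, mem_Ioi]
  constructor
  · intro h β hβ
    obtain ⟨hαβ, hβ0⟩ := max_lt_iff.mp hβ
    have hlt : mtime Ω F x < ENNReal.ofReal β :=
      h.trans_lt ((ENNReal.ofReal_lt_ofReal_iff hβ0).mpr hαβ)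
    simp only [mtime, iInf_lt_iff] at hlt
    obtain ⟨t, ⟨ht0, q, hq, hmem⟩, htβ⟩ := hlt
    exact ⟨t, ⟨ht0, ((ENNReal.ofReal_lt_ofReal_iff hβ0).mp htβ).le⟩, q, hq, hmem⟩
  · intro h
    have key : ∀ β > max α 0, mtime Ω F x ≤ ENNReal.ofReal β := by
      intro β hβ
      obtain ⟨t, ht, q, hq, hmem⟩ := h β hβ
      exact (iInf₂_le t ⟨ht.1, q, hq, hmem⟩).trans (ENNReal.ofReal_le_ofReal ht.2)
    have hlim : Tendsto ENNReal.ofReal (𝓝[>] (max α 0)) (𝓝 (ENNReal.ofReal (max α 0))) :=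
      ENNReal.continuous_ofReal.continuousWithinAt
    simpa using ge_of_tendsto hlim (eventually_mem_nhdsWithin.mono key)

/-- Proposition 3.5: lower semicontinuity of minimal time functions:
if `X` is finite-dimensional, or `X` is reflexive and `Ω` is convex, then
every level set `{x : T(x) ≤ α}`, `α ∈ ℝ`, is closed. -/
theorem mtime_lowerSemicontinuous [NormedAddCommGroup X] [NormedSpace ℝ X]
    [CompleteSpace X]
    (Ω F : Set X) (hΩne : Ω.Nonempty) (hΩcl : IsClosed Ω)
    (hFne : F.Nonempty) (hFcl : IsClosed F) (hFbd : Bornology.IsBounded F)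
    (hFcv : Convex ℝ F)
    (hX : FiniteDimensional ℝ X ∨
      (Function.Surjective (NormedSpace.inclusionInDoubleDual ℝ X) ∧ Convex ℝ Ω)) :
    ∀ α : ℝ, IsClosed {x : X | mtime Ω F x ≤ ENNReal.ofReal α} := by
  intro α
  rw [setOf_mtime_le_ofReal]
  refine isClosed_biInter fun β _ => ?_
  rcases hX with hfin | ⟨hrefl, hΩcv⟩
  · have : ProperSpace X := FiniteDimensional.proper ℝ X
    exact isClosed_setOf_exists_add_smul_mem hΩcl
      (Metric.isCompact_of_isClosed_isBounded hFcl hFbd) β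
  · have hΩw : IsClosed (toWeakSpace ℝ X '' Ω) := by
      rw [← hΩcl.closure_eq, hΩcv.toWeakSpace_closure ℝ]
      exact isClosed_closure
    have h := (isClosed_setOf_exists_add_smul_mem hΩw
      (hFcv.isCompact_toWeakSpace_image hrefl hFcl hFbd) β).preimage
      (toWeakSpaceCLM ℝ X).continuous
    convert h using 1
    ext x
    simp only [mem_ofPred_eq, mem_preimage, exists_mem_image, toWeakSpaceCLM_eq_toWeakSpace,
      ← map_smul, ← map_add, (toWeakSpace ℝ X).injective.mem_set_image]
end

section
/- Assume that the complement Ω^c := X \ Ω of the target is convex and that T(x) < ∞ for every x ∈ Ω^c. Then T is concave on Ω^c, i.e., T(λx₁ + (1−λ)x₂) ≥ λT(x₁) + (1−λ)T(x₂) for all x₁, x₂ ∈ Ω^c and λ ∈ (0,1) such that λx₁ + (1−λ)x₂ ∈ Ω^c. -/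
open Set Filter Topology Pointwise
open scoped ENNReal

variable {X : Type*}

/-- Before the minimal time, no admissible direction reaches the target. -/
theorem notMem_of_lt_mtime [NormedAddCommGroup X] [NormedSpace ℝ X]
    {Ω F : Set X} {x q : X} {t : ℝ} (ht : 0 ≤ t) (hq : q ∈ F)
    (h : ENNReal.ofReal t < mtime Ω F x) : x + t • q ∉ Ω :=
  fun hmem => h.not_ge (iInf₂_le t ⟨ht, q, hq, hmem⟩)

/-- From a point outside the target, following an admissible direction for a fraction `s < 1`
of the minimal time stays outside the target. -/
theorem add_mul_mtime_smul_notMem [NormedAddCommGroup X] [NormedSpace ℝ X]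
    {Ω F : Set X} {x q : X} {s : ℝ} (hx : x ∉ Ω) (hfin : mtime Ω F x < ⊤) (hq : q ∈ F)
    (hs0 : 0 ≤ s) (hs1 : s < 1) : x + (s * (mtime Ω F x).toReal) • q ∉ Ω := by
  rcases (ENNReal.toReal_nonneg (a := mtime Ω F x)).eq_or_lt with h0 | hpos
  · simpa [← h0] using hx
  · refine notMem_of_lt_mtime (by positivity) hq ?_
    rw [ENNReal.ofReal_lt_iff_lt_toReal (by positivity) hfin.ne]
    exact mul_lt_of_lt_one_left hpos hs1

/-- Proposition 3.7: concavity of minimal time functions: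
if the complement of `Ω` is convex and `T` is finite on it, then `T` is
concave on `Ωᶜ`. -/
theorem mtime_concave_on_compl [NormedAddCommGroup X] [NormedSpace ℝ X]
    [CompleteSpace X]
    (Ω F : Set X) (hΩne : Ω.Nonempty) (hΩcl : IsClosed Ω)
    (hFne : F.Nonempty) (hFcl : IsClosed F) (hFbd : Bornology.IsBounded F)
    (hFcv : Convex ℝ F)
    (hcv : Convex ℝ Ωᶜ) (hfin : ∀ x ∈ Ωᶜ, mtime Ω F x < ⊤)
    (x₁ x₂ : X) (h1 : x₁ ∈ Ωᶜ) (h2 : x₂ ∈ Ωᶜ)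
    (l : ℝ) (hl0 : 0 < l) (hl1 : l < 1)
    (hc : l • x₁ + (1 - l) • x₂ ∈ Ωᶜ) :
    ENNReal.ofReal l * mtime Ω F x₁ + ENNReal.ofReal (1 - l) * mtime Ω F x₂ ≤
      mtime Ω F (l • x₁ + (1 - l) • x₂) := by
  have hl1' : 0 < 1 - l := sub_pos.2 hl1
  refine le_iInf₂ fun t ⟨ht, q, hq, hmem⟩ => ?_
  set a := (mtime Ω F x₁).toReal with ha
  set b := (mtime Ω F x₂).toReal with hb
  have ha0 : 0 ≤ a := ENNReal.toReal_nonneg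
  have hb0 : 0 ≤ b := ENNReal.toReal_nonneg
  rw [← ENNReal.ofReal_toReal (hfin x₁ h1).ne, ← ENNReal.ofReal_toReal (hfin x₂ h2).ne,
    ← ENNReal.ofReal_mul hl0.le, ← ENNReal.ofReal_mul hl1'.le,
    ← ENNReal.ofReal_add (by positivity) (by positivity)]
  refine ENNReal.ofReal_le_ofReal ?_
  by_contra! hlt
  have hpos : 0 < l * a + (1 - l) * b := ht.trans_lt hlt
  set s := t / (l * a + (1 - l) * b)
  have hs0 : 0 ≤ s := div_nonneg ht hpos.le
  have hs1 : s < 1 := (div_lt_one hpos).2 hlt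
  have hst : t = l * (s * a) + (1 - l) * (s * b) := by
    rw [← div_mul_cancel₀ t hpos.ne']
    ring
  refine hcv (add_mul_mtime_smul_notMem h1 (hfin x₁ h1) hq hs0 hs1)
    (add_mul_mtime_smul_notMem h2 (hfin x₂ h2) hq hs0 hs1) hl0.le hl1'.le (by ring) ?_
  convert hmem using 1
  rw [← ha, ← hb, hst]
  module
end

section
/- Let x̄ ∈ Ω and ε ≥ 0. Then every x* ∈ N̂_ε(x̄; Ω) with σ_F(−x*) ≤ 1 + ε·‖F‖ satisfies x* ∈ ∂̂_{με} T(x̄), where μ = μ(x*) := 1 + 2‖F‖·‖x*‖. -/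
open Set Filter Topology Pointwise
open scoped ENNReal

variable {X : Type*}

theorem norm_le_dynBound [NormedAddCommGroup X] {F : Set X}
    (hF : Bornology.IsBounded F) {q : X} (hq : q ∈ F) : ‖q‖ ≤ dynBound F := by
  obtain ⟨C, hC⟩ := hF.exists_norm_le
  exact le_csSup ⟨C, by rintro _ ⟨y, hy, rfl⟩; exact hC y hy⟩ ⟨q, hq, rfl⟩

theorem apply_le_suppFn [NormedAddCommGroup X] [NormedSpace ℝ X] {F : Set X}
    (hF : Bornology.IsBounded F) (p : X →L[ℝ] ℝ) {q : X} (hq : q ∈ F) :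
    p q ≤ suppFn F p := by
  obtain ⟨C, hC⟩ := hF.exists_norm_le
  refine le_csSup ⟨‖p‖ * C, ?_⟩ ⟨q, hq, rfl⟩
  rintro _ ⟨y, hy, rfl⟩
  exact (le_abs_self _).trans ((p.le_opNorm y).trans (by gcongr; exact hC y hy))

theorem mtime_eq_zero_of_mem [NormedAddCommGroup X] [NormedSpace ℝ X] {Ω F : Set X}
    (hF : F.Nonempty) {x : X} (hx : x ∈ Ω) : mtime Ω F x = 0 := by
  obtain ⟨q, hq⟩ := hF
  have h : mtime Ω F x ≤ ENNReal.ofReal 0 :=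
    iInf₂_le (0 : ℝ) ⟨le_rfl, q, hq, by simpa using hx⟩
  simpa using h

/-- Proposition 4.2: lower estimate of `ε`-subdifferentials of minimal time
functions at in-set points: every `x* ∈ N̂_ε(x̄; Ω) ∩ C*_ε` belongs to
`∂̂_{με} T(x̄)` with `μ = 1 + 2‖F‖·‖x*‖`. -/
theorem enormal_subset_fsub_mtime_inset [NormedAddCommGroup X] [NormedSpace ℝ X]
    [CompleteSpace X]
    (Ω F : Set X) (hΩne : Ω.Nonempty) (hΩcl : IsClosed Ω)
    (hFne : F.Nonempty) (hFcl : IsClosed F) (hFbd : Bornology.IsBounded F)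
    (hFcv : Convex ℝ F)
    (xb : X) (hxb : xb ∈ Ω) (ε : ℝ) (hε : 0 ≤ ε)
    (p : X →L[ℝ] ℝ) (hp : p ∈ enormal Ω ε xb)
    (hσ : suppFn F (-p) ≤ 1 + ε * dynBound F) :
    p ∈ fsub (mtime Ω F) ((1 + 2 * dynBound F * ‖p‖) * ε) xb := by
  intro γ hγ
  set M := dynBound F
  have hM : 0 ≤ M := by
    obtain ⟨q, hq⟩ := hFne
    exact (norm_nonneg q).trans (norm_le_dynBound hFbd hq)
  have hK : 0 < 1 + M * ‖p‖ := by positivity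
  obtain ⟨δ, hδ, hnormal⟩ := hp (γ / (1 + M * ‖p‖)) (by positivity)
  refine ⟨δ / (1 + M * ‖p‖), by positivity, fun x hx => ?_⟩
  rw [mtime_eq_zero_of_mem hFne hxb, ENNReal.toReal_zero, zero_add]
  refine le_iInf₂ fun t ht => ENNReal.ofReal_le_ofReal ?_
  obtain ⟨ht0, q, hq, hw⟩ := ht
  have hrhs : 0 ≤ ((1 + 2 * M * ‖p‖) * ε + γ) * ‖x - xb‖ := by positivity
  rcases le_total (p (x - xb)) t with h | h
  · linarith
  have htp : t ≤ ‖p‖ * ‖x - xb‖ := h.trans ((le_abs_self _).trans (p.le_opNorm _))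
  have hsub : x + t • q - xb = (x - xb) + t • q := by abel
  have htM : t * M ≤ M * ‖p‖ * ‖x - xb‖ := by
    calc t * M ≤ (‖p‖ * ‖x - xb‖) * M := by gcongr
      _ = M * ‖p‖ * ‖x - xb‖ := by ring
  have hdist : ‖x + t • q - xb‖ ≤ (1 + M * ‖p‖) * ‖x - xb‖ := by
    have htq : ‖t • q‖ ≤ t * M := by
      rw [norm_smul, Real.norm_of_nonneg ht0]
      gcongr
      exact norm_le_dynBound hFbd hq
    rw [hsub]
    linarith [norm_add_le (x - xb) (t • q)]
  have hnear : ‖x + t • q - xb‖ < δ := by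
    rw [lt_div_iff₀' hK] at hx
    exact hdist.trans_lt hx
  have hpw : p (x - xb) + t * p q ≤
      (ε + γ / (1 + M * ‖p‖)) * ((1 + M * ‖p‖) * ‖x - xb‖) := by
    have h₁ := hnormal _ hw hnear
    rw [hsub, map_add, map_smul, smul_eq_mul, ← hsub] at h₁
    exact h₁.trans (by gcongr)
  have hpq : t * -p q ≤ t * (1 + ε * M) := by
    gcongr
    exact (apply_le_suppFn hFbd (-p) hq).trans hσ
  have hcancel : (ε + γ / (1 + M * ‖p‖)) * ((1 + M * ‖p‖) * ‖x - xb‖) =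
      (ε * (1 + M * ‖p‖) + γ) * ‖x - xb‖ := by
    field_simp
  have hεtM := mul_le_mul_of_nonneg_left htM hε
  rw [hcancel] at hpw
  linarith
end

section
/- Let x̄ ∉ Ω with T(x̄) < ∞. Then for every ε ≥ 0, every x* ∈ ∂̂_ε T(x̄), and every η > 0, there exists a point w̄ ∈ Ω such that x* ∈ N̂_{ε+η}(w̄; Ω) and ‖x̄ − w̄‖ ≤ ‖F‖·T(x̄) + η. -/
open Set Filter Topology Pointwise
open scoped ENNReal

variable {X : Type*}

/-- Ekeland's variational principle. -/
theorem exists_ekeland_point {α : Type*} [MetricSpace α] [CompleteSpace α] {f : α → ℝ}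
    (hf : LowerSemicontinuous f) (hbdd : BddBelow (range f)) {ν : ℝ} (hν : 0 < ν) (x₀ : α) :
    ∃ y, f y + ν * dist x₀ y ≤ f x₀ ∧ ∀ z, z ≠ y → f y < f z + ν * dist y z := by
  let S : α → Set α := fun x => {y | f y + ν * dist x y ≤ f x}
  have hself : ∀ x, x ∈ S x := fun x => by simp [S]
  have hmono : ∀ x, ∀ y ∈ S x, S y ⊆ S x := by
    intro x y hy z hz
    simp only [S, mem_ofPred_eq] at hy hz ⊢
    nlinarith [mul_le_mul_of_nonneg_left (dist_triangle x y z) hν.le]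
  have hclosed : ∀ x, IsClosed (S x) := by
    intro x
    have hcont : Continuous fun y => ν * dist x y := by fun_prop
    exact (hf.add hcont.lowerSemicontinuous).isClosed_preimage (f x)
  have hstep : ∀ (n : ℕ) (x : α), ∃ y ∈ S x, ∀ z ∈ S x, f y ≤ f z + (1 / 2 : ℝ) ^ n := by
    intro n x
    have hb : BddBelow (f '' S x) := hbdd.mono (image_subset_range _ _)
    obtain ⟨_, ⟨y, hy, rfl⟩, hlt⟩ := exists_lt_of_csInf_lt
      (⟨f x, mem_image_of_mem f (hself x)⟩ : (f '' S x).Nonempty)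
      (lt_add_of_pos_right (sInf (f '' S x)) (by positivity : (0 : ℝ) < (1 / 2) ^ n))
    refine ⟨y, hy, fun z hz => ?_⟩
    linarith [csInf_le hb (mem_image_of_mem f hz)]
  choose next hnext_mem hnext_le using hstep
  let u : ℕ → α := fun n => Nat.rec x₀ next n
  have hu_anti : Antitone fun n => S (u n) :=
    antitone_nat_of_succ_le fun n => hmono _ _ (hnext_mem n (u n))
  have hsmall : ∀ n, ∀ z ∈ S (u (n + 1)), dist (u (n + 1)) z ≤ (1 / 2 : ℝ) ^ n / ν := by
    intro n z hz
    have hle := hnext_le n (u n) z (hu_anti n.le_succ hz)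
    change f (u (n + 1)) ≤ _ at hle
    simp only [S, mem_ofPred_eq] at hz
    rw [le_div_iff₀ hν]
    linarith
  have hlim : Tendsto (fun n : ℕ => (1 / 2 : ℝ) ^ n / ν) atTop (𝓝 0) := by
    simpa using (tendsto_pow_atTop_nhds_zero_of_lt_one (r := (1 / 2 : ℝ))
      (by norm_num) (by norm_num)).div_const ν
  have hcauchy : CauchySeq fun n => u (n + 1) :=
    cauchySeq_of_le_tendsto_0' _
      (fun n m hnm => hsmall n _ (hu_anti (Nat.succ_le_succ hnm) (hself _))) hlim
  obtain ⟨y, hy⟩ := cauchySeq_tendsto_of_complete hcauchy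
  have hyS : ∀ n, y ∈ S (u n) := fun n =>
    (hclosed _).mem_of_tendsto hy <| (eventually_ge_atTop n).mono fun m hm =>
      hu_anti (hm.trans m.le_succ) (hself _)
  refine ⟨y, hyS 0, fun z hzy => ?_⟩
  by_contra! hz
  have hzlim : Tendsto (fun n => u (n + 1)) atTop (𝓝 z) :=
    tendsto_iff_dist_tendsto_zero.2 <|
      squeeze_zero (fun _ => dist_nonneg) (fun n => hsmall n z (hmono _ _ (hyS (n + 1)) hz)) hlim
  exact hzy (tendsto_nhds_unique hzlim hy)

/-- An almost minimizer `w₀` over a closed set of the `c`-calmness defect of `p` can be moved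
slightly to a point at which `p` is a `(c + ν)`-normal. -/
theorem exists_enormal_near [NormedAddCommGroup X] [NormedSpace ℝ X] [CompleteSpace X]
    {Ω : Set X} (hΩ : IsClosed Ω) {p : X →L[ℝ] ℝ} {c ν δ : ℝ} (hc : 0 ≤ c) (hν : 0 < ν)
    (hνδ : ν < δ) {w₀ : X} (hw₀ : w₀ ∈ Ω)
    (h : ∀ w ∈ Ω, ‖w - w₀‖ ≤ δ → p (w - w₀) ≤ c * ‖w - w₀‖ + ν ^ 2) :
    ∃ w ∈ Ω, p ∈ enormal Ω (c + ν) w ∧ ‖w - w₀‖ ≤ ν := by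
  let K : Set X := Ω ∩ Metric.closedBall w₀ δ
  have hK : IsClosed K := hΩ.inter Metric.isClosed_closedBall
  have : CompleteSpace K := hK.completeSpace_coe
  let f : K → ℝ := fun w => c * ‖(w : X) - w₀‖ - p (w - w₀)
  have hf : Continuous f := by fun_prop
  have hlow : ∀ w : K, -ν ^ 2 ≤ f w := by
    intro w
    have := h w w.2.1 (by simpa [dist_eq_norm] using w.2.2)
    simp only [f]
    linarith
  have hw₀K : w₀ ∈ K := ⟨hw₀, Metric.mem_closedBall_self (hν.trans hνδ).le⟩
  obtain ⟨⟨y, hyK⟩, hy, hmin⟩ := exists_ekeland_point hf.lowerSemicontinuous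
    ⟨-ν ^ 2, by rintro _ ⟨w, rfl⟩; exact hlow w⟩ hν ⟨w₀, hw₀K⟩
  have hyν : ‖y - w₀‖ ≤ ν := by
    have hl := hlow ⟨y, hyK⟩
    have hz : f ⟨w₀, hw₀K⟩ = 0 := by simp [f]
    rw [hz, Subtype.dist_eq, dist_eq_norm, norm_sub_rev] at hy
    exact le_of_mul_le_mul_left (by nlinarith) hν
  refine ⟨y, hyK.1, fun γ hγ => ⟨δ - ν, sub_pos.2 hνδ, fun w hw hwy => ?_⟩, hyν⟩
  have htri : ‖w - w₀‖ ≤ ‖w - y‖ + ‖y - w₀‖ := norm_sub_le_norm_sub_add_norm_sub w y w₀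
  have hwK : w ∈ K := ⟨hw, by rw [Metric.mem_closedBall, dist_eq_norm]; linarith⟩
  rcases eq_or_ne w y with rfl | hne
  · simp
  have hlt := hmin ⟨w, hwK⟩ (by simpa using hne)
  simp only [f, Subtype.dist_eq, dist_eq_norm, map_sub, norm_sub_rev y w] at hlt
  rw [map_sub]
  nlinarith [mul_le_mul_of_nonneg_left htri hc, mul_nonneg hγ.le (norm_nonneg (w - y))]

theorem exists_mtime_lt_add [NormedAddCommGroup X] [NormedSpace ℝ X] {Ω F : Set X} {x : X}
    (hfin : mtime Ω F x < ⊤) {r : ℝ} (hr : 0 < r) :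
    ∃ t, 0 ≤ t ∧ t < (mtime Ω F x).toReal + r ∧ ∃ q ∈ F, x + t • q ∈ Ω := by
  have hlt : mtime Ω F x < ENNReal.ofReal ((mtime Ω F x).toReal + r) := by
    rw [ENNReal.lt_ofReal_iff_toReal_lt hfin.ne]
    linarith
  obtain ⟨t, ht⟩ := iInf_lt_iff.1 hlt
  obtain ⟨⟨ht0, q, hq, hw⟩, ht⟩ := iInf_lt_iff.1 ht
  exact ⟨t, ht0, (ENNReal.ofReal_lt_ofReal_iff_of_nonneg ht0).1 ht, q, hq, hw⟩

/-- Theorem 4.3: `ε`-subgradients of minimal time functions at out-of-set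
points via perturbed normals to target sets. -/
theorem fsub_mtime_perturbed_normal [NormedAddCommGroup X] [NormedSpace ℝ X]
    [CompleteSpace X]
    (Ω F : Set X) (hΩne : Ω.Nonempty) (hΩcl : IsClosed Ω)
    (hFne : F.Nonempty) (hFcl : IsClosed F) (hFbd : Bornology.IsBounded F)
    (hFcv : Convex ℝ F)
    (xb : X) (hxb : xb ∉ Ω) (hfin : mtime Ω F xb < ⊤)
    (ε : ℝ) (hε : 0 ≤ ε) (p : X →L[ℝ] ℝ) (hp : p ∈ fsub (mtime Ω F) ε xb)
    (η : ℝ) (hη : 0 < η) :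
    ∃ wb ∈ Ω, p ∈ enormal Ω (ε + η) wb ∧
      ‖xb - wb‖ ≤ dynBound F * (mtime Ω F xb).toReal + η := by
  obtain ⟨δ, hδ, hsub⟩ := hp (η / 2) (by positivity)
  have hM : 0 ≤ dynBound F :=
    (norm_nonneg _).trans (norm_le_dynBound hFbd hFne.some_mem)
  set M := dynBound F
  set T := (mtime Ω F xb).toReal
  obtain ⟨ν, hν, hνlt⟩ := exists_between
    (show (0 : ℝ) < min (min (δ / 2) 1) (η / (2 * (M + 1))) by positivity)
  obtain ⟨⟨hνδ, hν1⟩, hνη⟩ : (ν < δ / 2 ∧ ν < 1) ∧ ν < η / (2 * (M + 1)) := by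
    simpa only [lt_min_iff] using hνlt
  rw [lt_div_iff₀ (by positivity)] at hνη
  obtain ⟨t, ht0, ht, q, hq, hw₀⟩ := exists_mtime_lt_add hfin (pow_pos hν 2)
  obtain ⟨wb, hwb, hnormal, hdist⟩ := exists_enormal_near hΩcl (p := p) (c := ε + η / 2)
    (by positivity) hν hνδ hw₀ (fun w hw hwδ => by
      have hx := hsub (xb + (w - (xb + t • q))) (by rw [add_sub_cancel_left]; linarith)
      have hle : mtime Ω F (xb + (w - (xb + t • q))) ≤ ENNReal.ofReal t :=
        mtime_le_ofReal ht0 hq (by convert hw using 1; abel)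
      have := (ENNReal.ofReal_le_ofReal_iff ht0).1 (hx.trans hle)
      rw [add_sub_cancel_left] at this
      linarith)
  refine ⟨wb, hwb, fun γ hγ => ?_, ?_⟩
  · obtain ⟨r, hr, hball⟩ := hnormal γ hγ
    refine ⟨r, hr, fun w hw hwr => (hball w hw hwr).trans ?_⟩
    exact mul_le_mul_of_nonneg_right (by nlinarith) (norm_nonneg _)
  · have hq' : ‖t • q‖ ≤ t * M := by
      rw [norm_smul, Real.norm_of_nonneg ht0]
      exact mul_le_mul_of_nonneg_left (norm_le_dynBound hFbd hq) ht0
    have htri : ‖xb - wb‖ ≤ ‖t • q‖ + ‖wb - (xb + t • q)‖ := by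
      rw [show xb - wb = -(t • q) - (wb - (xb + t • q)) by abel, ← norm_neg (t • q)]
      exact norm_sub_le _ _
    have hνsq : ν ^ 2 ≤ ν := by nlinarith
    nlinarith [mul_le_mul_of_nonneg_right ht.le hM, mul_le_mul_of_nonneg_right hνsq hM]
end

section
/- Let x̄ ∉ Ω with T(x̄) < ∞ and suppose the generalized projection Π(x̄) is nonempty. Then for every w̄ ∈ Π(x̄) and every ε ≥ 0 one has ∂̂_ε T(x̄) ⊆ (−∂̂_ε ρ_F(w̄ − x̄)) ∩ N̂_ε(w̄; Ω). -/
open Set Filter Topology Pointwise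
open scoped ENNReal

variable {X : Type*}

/-- The minimal time is at most the gauge of the displacement to any point of the target. -/
theorem mtime_le_mgauge_sub [NormedAddCommGroup X] [NormedSpace ℝ X]
    {Ω F : Set X} {w : X} (hw : w ∈ Ω) (x : X) : mtime Ω F x ≤ mgauge F (w - x) := by
  refine le_iInf₂ fun t ⟨ht, q, hq, hwx⟩ => iInf₂_le t ⟨ht, q, hq, ?_⟩
  rwa [← hwx, add_sub_cancel]

/-- The gauge of the displacement to a projection point is the minimal time. -/
theorem mgauge_sub_eq_mtime [NormedAddCommGroup X] [NormedSpace ℝ X]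
    {Ω F : Set X} {x w : X} (hfin : mtime Ω F x < ⊤) (hw : w ∈ mproj Ω F x) :
    mgauge F (w - x) = mtime Ω F x := by
  obtain ⟨hwΩ, q, hq, hwq⟩ := hw
  refine le_antisymm ?_ (mtime_le_mgauge_sub hwΩ x)
  calc mgauge F (w - x) ≤ ENNReal.ofReal (mtime Ω F x).toReal :=
        iInf₂_le _ ⟨ENNReal.toReal_nonneg, q, hq, sub_eq_of_eq_add' hwq⟩
    _ = mtime Ω F x := ENNReal.ofReal_toReal hfin.ne

/-- Proposition 4.5: upper estimate of `ε`-subgradients of minimal time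
functions at out-of-set points via projections on targets:
`∂̂_ε T(x̄) ⊆ (−∂̂_ε ρ_F(w̄ − x̄)) ∩ N̂_ε(w̄; Ω)`. -/
theorem fsub_mtime_subset_proj [NormedAddCommGroup X] [NormedSpace ℝ X]
    [CompleteSpace X]
    (Ω F : Set X) (hΩne : Ω.Nonempty) (hΩcl : IsClosed Ω)
    (hFne : F.Nonempty) (hFcl : IsClosed F) (hFbd : Bornology.IsBounded F)
    (hFcv : Convex ℝ F)
    (xb : X) (hxb : xb ∉ Ω) (hfin : mtime Ω F xb < ⊤)
    (hne : (mproj Ω F xb).Nonempty)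
    (wb : X) (hwb : wb ∈ mproj Ω F xb) (ε : ℝ) (hε : 0 ≤ ε) :
    fsub (mtime Ω F) ε xb ⊆
      (-(fsub (mgauge F) ε (wb - xb))) ∩ enormal Ω ε wb := by
  intro p hp
  refine ⟨fun γ hγ => ?_, fun γ hγ => ?_⟩
  · obtain ⟨δ, hδ, h⟩ := hp γ hγ
    refine ⟨δ, hδ, fun u hu => ?_⟩
    have hux : wb - u - xb = -(u - (wb - xb)) := by abel
    have hTu := h (wb - u) (by rwa [hux, norm_neg])
    rw [hux, norm_neg, map_neg] at hTu
    rw [mgauge_sub_eq_mtime hfin hwb, neg_apply]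
    refine hTu.trans ?_
    simpa using mtime_le_mgauge_sub (F := F) hwb.1 (wb - u)
  · obtain ⟨δ, hδ, h⟩ := hp γ hγ
    refine ⟨δ, hδ, fun w hw hwδ => ?_⟩
    obtain ⟨-, q, hq, hwq⟩ := hwb
    have hTw := h (xb + (w - wb)) (by rwa [add_sub_cancel_left])
    rw [add_sub_cancel_left] at hTw
    have hle : mtime Ω F (xb + (w - wb)) ≤ ENNReal.ofReal (mtime Ω F xb).toReal := by
      refine iInf₂_le _ ⟨ENNReal.toReal_nonneg, q, hq, ?_⟩
      rwa [add_right_comm, ← hwq, add_sub_cancel]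
    have := (ENNReal.ofReal_le_ofReal_iff ENNReal.toReal_nonneg).1 (hTw.trans hle)
    linarith
end

section
/- Let x̄ ∈ Ω. Then the basic (limiting) subdifferential satisfies ∂T(x̄) ⊆ N(x̄; Ω) ∩ C*, where C* := {x* ∈ X* : σ_F(−x*) ≤ 1}. This inclusion holds as equality when the support function σ_F is sequentially weak* continuous on the set −[N(x̄; Ω) ∩ C*] (in particular, when X is finite-dimensional). If in addition 0 ∈ F, then N(x̄; Ω) = ⋃_{λ>0} λ·∂T(x̄). -/
open Set Filter Topology Pointwise
open scoped ENNReal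

variable {X : Type*}

/-- Ekeland's variational principle for a continuous function on a closed subset of a complete
metric space. -/
theorem exists_ekeland_point_s14 {α : Type*} [MetricSpace α] [CompleteSpace α] {K : Set α}
    (hK : IsClosed K) {f : α → ℝ} (hf : Continuous f) {m : ℝ} (hm : ∀ y ∈ K, m ≤ f y)
    {w : α} (hw : w ∈ K) {η : ℝ} (hη : 0 < η) :
    ∃ z ∈ K, f z + η * dist z w ≤ f w ∧ ∀ y ∈ K, f z ≤ f y + η * dist y z := by
  have hstep : ∀ (n : ℕ) (x : α), ∃ y, x ∈ K → (y ∈ K ∧ f y + η * dist y x ≤ f x ∧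
      ∀ u ∈ K, f u + η * dist u x ≤ f x → f y ≤ f u + 1 / ((n : ℝ) + 1)) := by
    intro n x
    by_cases hx : x ∈ K
    · have hbdd : BddBelow (f '' {y | y ∈ K ∧ f y + η * dist y x ≤ f x}) := by
        refine ⟨m, ?_⟩
        rintro _ ⟨y, hy, rfl⟩
        exact hm y hy.1
      have hne : (f '' {y | y ∈ K ∧ f y + η * dist y x ≤ f x}).Nonempty :=
        ⟨f x, x, ⟨hx, by simp⟩, rfl⟩
      obtain ⟨_, ⟨y, hy, rfl⟩, hlt⟩ := exists_lt_of_csInf_lt hne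
        (lt_add_of_pos_right _ (Nat.one_div_pos_of_nat (n := n) (α := ℝ)))
      refine ⟨y, fun _ => ⟨hy.1, hy.2, fun u hu hux => hlt.le.trans ?_⟩⟩
      gcongr
      exact csInf_le hbdd ⟨u, ⟨hu, hux⟩, rfl⟩
    · exact ⟨x, fun h => absurd h hx⟩
  choose g hg using hstep
  let s : ℕ → α := fun n => Nat.rec w (fun n x => g n x) n
  have hsK : ∀ n, s n ∈ K := by
    intro n
    induction n with
    | zero => exact hw
    | succ n ih => exact (hg n (s n) ih).1
  have hs_succ : ∀ n, f (s (n + 1)) + η * dist (s (n + 1)) (s n) ≤ f (s n) :=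
    fun n => (hg n (s n) (hsK n)).2.1
  have hs_min : ∀ n, ∀ u ∈ K, f u + η * dist u (s n) ≤ f (s n) →
      f (s (n + 1)) ≤ f u + 1 / ((n : ℝ) + 1) :=
    fun n => (hg n (s n) (hsK n)).2.2
  have hs_le : ∀ n k, f (s (n + k)) + η * dist (s (n + k)) (s n) ≤ f (s n) := by
    intro n k
    induction k with
    | zero => simp
    | succ k ih =>
      have h₁ := hs_succ (n + k)
      have h₂ := mul_le_mul_of_nonneg_left
        (dist_triangle (s (n + k + 1)) (s (n + k)) (s n)) hη.le
      rw [← add_assoc]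
      linarith
  have hanti : Antitone (fun n => f (s n)) := antitone_nat_of_succ_le fun n => by
    have := hs_succ n
    have : 0 ≤ η * dist (s (n + 1)) (s n) := by positivity
    linarith
  have hconv : Tendsto (fun n => f (s n)) atTop (𝓝 (⨅ n, f (s n))) :=
    tendsto_atTop_ciInf hanti ⟨m, by rintro _ ⟨n, rfl⟩; exact hm _ (hsK n)⟩
  have hcauchy : CauchySeq s := by
    rw [Metric.cauchySeq_iff']
    intro ε hε
    obtain ⟨N, hN⟩ := Metric.cauchySeq_iff'.1 hconv.cauchySeq (η * ε) (by positivity)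
    refine ⟨N, fun n hn => ?_⟩
    obtain ⟨k, rfl⟩ := Nat.exists_eq_add_of_le hn
    have h₁ := hs_le N k
    have h₂ := hN _ hn
    rw [Real.dist_eq, abs_lt] at h₂
    exact lt_of_mul_lt_mul_left (by linarith : η * dist (s (N + k)) (s N) < η * ε) hη.le
  obtain ⟨z, hz⟩ := cauchySeq_tendsto_of_complete hcauchy
  have hz_le : ∀ n, f z + η * dist z (s n) ≤ f (s n) := by
    intro n
    have hcont : Continuous fun y => f y + η * dist y (s n) := by fun_prop
    refine le_of_tendsto ((hcont.tendsto z).comp hz) ?_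
    filter_upwards [eventually_ge_atTop n] with k hk
    obtain ⟨j, rfl⟩ := Nat.exists_eq_add_of_le hk
    exact hs_le n j
  refine ⟨z, hK.mem_of_tendsto hz (Eventually.of_forall hsK), hz_le 0, fun y hy => ?_⟩
  by_contra! hlt
  have hfz : ∀ n : ℕ, f z ≤ f y + 1 / ((n : ℝ) + 1) := by
    intro n
    have h₁ := hz_le (n + 1)
    have h₂ : 0 ≤ η * dist z (s (n + 1)) := by positivity
    have h₃ := mul_le_mul_of_nonneg_left (dist_triangle y z (s n)) hη.le
    have h₄ := hs_min n y hy (by linarith [hz_le n])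
    linarith
  have hlim : Tendsto (fun n : ℕ => f y + 1 / ((n : ℝ) + 1)) atTop (𝓝 (f y)) := by
    simpa using tendsto_one_div_add_atTop_nhds_zero_nat.const_add (f y)
  have : f z ≤ f y := ge_of_tendsto' hlim hfz
  have : 0 ≤ η * dist y z := by positivity
  linarith

section MinimalTime

variable [NormedAddCommGroup X] [NormedSpace ℝ X] {Ω F : Set X}

theorem mtime_le {x q : X} {t : ℝ} (ht : 0 ≤ t) (hq : q ∈ F) (h : x + t • q ∈ Ω) :
    mtime Ω F x ≤ ENNReal.ofReal t :=
  iInf₂_le t ⟨ht, q, hq, h⟩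

theorem le_mtime {x : X} {a : ℝ≥0∞}
    (h : ∀ t : ℝ, 0 ≤ t → ∀ q ∈ F, x + t • q ∈ Ω → a ≤ ENNReal.ofReal t) :
    a ≤ mtime Ω F x :=
  le_iInf₂ fun t ht => by
    obtain ⟨ht, q, hq, hx⟩ := ht
    exact h t ht q hq hx

theorem exists_of_mtime_lt {x : X} {a : ℝ≥0∞} (h : mtime Ω F x < a) :
    ∃ t : ℝ, 0 ≤ t ∧ ENNReal.ofReal t < a ∧ ∃ q ∈ F, x + t • q ∈ Ω := by
  simp only [mtime, iInf_lt_iff] at h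
  obtain ⟨t, ⟨ht, hq⟩, hta⟩ := h
  exact ⟨t, ht, hta, hq⟩

theorem mtime_eq_zero (hF : F.Nonempty) {x : X} (hx : x ∈ Ω) : mtime Ω F x = 0 := by
  obtain ⟨q, hq⟩ := hF
  simpa using mtime_le (t := 0) le_rfl hq (by simpa using hx)

theorem mtime_sub_smul_le (hF : Convex ℝ F) {x q : X} {t : ℝ} (ht : 0 ≤ t) (hq : q ∈ F) :
    mtime Ω F (x - t • q) ≤ mtime Ω F x + ENNReal.ofReal t := by
  refine ENNReal.le_of_forall_pos_le_add fun ε hε hfin => ?_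
  have hTfin : mtime Ω F x ≠ ∞ := (ENNReal.add_lt_top.1 hfin).1.ne
  obtain ⟨s, hs, hslt, r, hr, hΩ⟩ := exists_of_mtime_lt
    (ENNReal.lt_add_right hTfin (ENNReal.coe_ne_zero.2 hε.ne'))
  have hmem : ∃ v ∈ F, t • q + s • r = (t + s) • v := by
    rcases (add_nonneg ht hs).eq_or_lt with h0 | hpos
    · have ht0 : t = 0 := by linarith
      have hs0 : s = 0 := by linarith
      exact ⟨q, hq, by simp [ht0, hs0]⟩
    · refine ⟨(t / (t + s)) • q + (s / (t + s)) • r,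
        hF hq hr (by positivity) (by positivity) (by field_simp), ?_⟩
      rw [smul_add, smul_smul, smul_smul, mul_div_cancel₀ _ hpos.ne',
        mul_div_cancel₀ _ hpos.ne']
  obtain ⟨v, hv, hveq⟩ := hmem
  have hle : mtime Ω F (x - t • q) ≤ ENNReal.ofReal (t + s) := by
    refine mtime_le (add_nonneg ht hs) hv ?_
    rw [← hveq]
    convert hΩ using 1
    abel
  calc mtime Ω F (x - t • q) ≤ ENNReal.ofReal t + ENNReal.ofReal s := by
        rwa [← ENNReal.ofReal_add ht hs]
    _ ≤ ENNReal.ofReal t + (mtime Ω F x + ε) := by gcongr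
    _ = mtime Ω F x + ENNReal.ofReal t + ε := by ring

theorem le_suppFn (hF : Bornology.IsBounded F) (p : X →L[ℝ] ℝ) {q : X} (hq : q ∈ F) :
    p q ≤ suppFn F p := by
  refine le_csSup ?_ ⟨q, hq, rfl⟩
  obtain ⟨M, hM⟩ := hF.exists_norm_le
  refine ⟨‖p‖ * M, ?_⟩
  rintro _ ⟨r, hr, rfl⟩
  exact (le_abs_self _).trans ((p.le_opNorm r).trans
    (mul_le_mul_of_nonneg_left (hM r hr) (norm_nonneg p)))

theorem suppFn_le (hF : F.Nonempty) {p : X →L[ℝ] ℝ} {a : ℝ} (h : ∀ q ∈ F, p q ≤ a) :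
    suppFn F p ≤ a := by
  refine csSup_le (hF.image _) ?_
  rintro _ ⟨q, hq, rfl⟩
  exact h q hq

theorem smul_mem_enormal {Θ : Set X} {x : X} {ε c : ℝ} (hc : 0 < c) {p : X →L[ℝ] ℝ}
    (hp : p ∈ enormal Θ ε x) : c • p ∈ enormal Θ (c * ε) x := by
  intro γ hγ
  obtain ⟨δ, hδ, H⟩ := hp (γ / c) (by positivity)
  refine ⟨δ, hδ, fun y hy hyx => ?_⟩
  have h := mul_le_mul_of_nonneg_left (H y hy hyx) hc.le
  rw [← mul_assoc, mul_add, mul_div_cancel₀ _ hc.ne'] at h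
  exact h

/-- The basic normal cone is stable under positive scaling. -/
theorem smul_mem_bnormal {Θ : Set X} {x : X} {c : ℝ} (hc : 0 < c) {p : X →L[ℝ] ℝ}
    (hp : p ∈ bnormal Θ x) : c • p ∈ bnormal Θ x := by
  obtain ⟨ε, u, ps, hε, hε0, hu, hux, hps, hlim⟩ := hp
  exact ⟨fun k => c * ε k, u, fun k => c • ps k, fun k => mul_nonneg hc.le (hε k),
    by simpa using hε0.const_mul c, hu, hux, fun k => smul_mem_enormal hc (hps k),
    fun v => by simpa using (hlim v).const_mul c⟩

/-- An `ε`-normal to the target with `σ_F(-p) ≤ 1` is an approximate Fréchet subgradient of the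
minimal time function. -/
theorem mem_fsub_mtime_of_mem_enormal (hFne : F.Nonempty) (hFbd : Bornology.IsBounded F)
    {M : ℝ} (hM0 : 0 ≤ M) (hM : ∀ q ∈ F, ‖q‖ ≤ M) {x : X} (hx : x ∈ Ω) {ε B : ℝ} (hε : 0 ≤ ε)
    {p : X →L[ℝ] ℝ} (hpB : ‖p‖ ≤ B) (hp : p ∈ enormal Ω ε x) (hσ : suppFn F (-p) ≤ 1) :
    p ∈ fsub (mtime Ω F) ((1 + M * B) * ε) x := by
  have hB : 0 ≤ B := (norm_nonneg p).trans hpB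
  have hC : 0 < 1 + M * B := by positivity
  intro γ hγ
  obtain ⟨δ, hδ, H⟩ := hp (γ / (1 + M * B)) (by positivity)
  refine ⟨δ / (1 + M * B), by positivity, fun y hy => le_mtime fun t ht q hq hyq => ?_⟩
  rw [mtime_eq_zero hFne hx]
  refine ENNReal.ofReal_le_ofReal ?_
  rw [lt_div_iff₀ hC] at hy
  have hpy : p (y - x) ≤ B * ‖y - x‖ := (le_abs_self _).trans (p.le_of_opNorm_le hpB _)
  simp only [ENNReal.toReal_zero, zero_add]
  have hpos : 0 ≤ ((1 + M * B) * ε + γ) * ‖y - x‖ := by positivity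
  rcases le_or_gt (B * ‖y - x‖) t with hbig | hsmall
  · linarith
  · have hdecomp : y + t • q - x = (y - x) + t • q := by abel
    have hnorm : ‖y + t • q - x‖ ≤ (1 + M * B) * ‖y - x‖ := by
      rw [hdecomp]
      calc ‖(y - x) + t • q‖ ≤ ‖y - x‖ + t * ‖q‖ := by
            refine (norm_add_le _ _).trans ?_
            rw [norm_smul, Real.norm_of_nonneg ht]
        _ ≤ ‖y - x‖ + (B * ‖y - x‖) * M := by
            gcongr
            exact hM q hq
        _ = (1 + M * B) * ‖y - x‖ := by ring
    have h₁ := H _ hyq (by linarith)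
    have h₂ : (ε + γ / (1 + M * B)) * ‖y + t • q - x‖ ≤
        ((1 + M * B) * ε + γ) * ‖y - x‖ := by
      calc _ ≤ (ε + γ / (1 + M * B)) * ((1 + M * B) * ‖y - x‖) := by gcongr
        _ = _ := by field_simp
    have h₃ : -p q ≤ 1 := (le_suppFn hFbd (-p) hq).trans hσ
    have h₄ := mul_le_mul_of_nonneg_left h₃ ht
    rw [hdecomp, map_add, map_smul, smul_eq_mul, ← hdecomp] at h₁
    linarith

/-- Approximate Fréchet subgradients of the minimal time function almost satisfy the polarity
bound with respect to the dynamics. -/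
theorem neg_apply_le_of_mem_fsub_mtime (hFcv : Convex ℝ F) {x : X} (hT : mtime Ω F x ≠ ∞) {ε : ℝ}
    {p : X →L[ℝ] ℝ} (hp : p ∈ fsub (mtime Ω F) ε x) {q : X} (hq : q ∈ F) :
    -p q ≤ 1 + ε * ‖q‖ := by
  have hγ : ∀ γ > 0, -p q ≤ 1 + ε * ‖q‖ + γ * ‖q‖ := by
    intro γ hγ
    obtain ⟨δ, hδ, H⟩ := hp γ hγ
    have ht : 0 < δ / (‖q‖ + 1) := by positivity
    set t := δ / (‖q‖ + 1) with ht_def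
    have hnorm : ‖x - t • q - x‖ = t * ‖q‖ := by
      rw [sub_sub_cancel_left, norm_neg, norm_smul, Real.norm_of_nonneg ht.le]
    have hlt : ‖x - t • q - x‖ < δ := by
      rw [hnorm, ht_def, div_mul_eq_mul_div, div_lt_iff₀ (by positivity)]
      linarith
    have h₁ := (H _ hlt).trans (mtime_sub_smul_le hFcv ht.le hq)
    rw [hnorm] at h₁
    nth_rewrite 2 [← ENNReal.ofReal_toReal hT] at h₁
    rw [← ENNReal.ofReal_add ENNReal.toReal_nonneg ht.le,
      ENNReal.ofReal_le_ofReal_iff (by positivity), sub_sub_cancel_left, map_neg, map_smul,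
      smul_eq_mul] at h₁
    exact le_of_mul_le_mul_left (by linarith : t * -p q ≤ t * (1 + ε * ‖q‖ + γ * ‖q‖)) ht
  refine le_of_forall_pos_le_add fun γ hγ' => (hγ (γ / (‖q‖ + 1)) (by positivity)).trans ?_
  gcongr
  rw [div_mul_eq_mul_div, div_le_iff₀ (by positivity)]
  linarith

/-- Approximate Fréchet subgradients of the minimal time function are approximate normals to the
target at points close to almost optimal projections. -/
theorem exists_mem_enormal_of_mem_fsub_mtime [CompleteSpace X] (hΩ : IsClosed Ω)
    {M : ℝ} (hM0 : 0 ≤ M) (hM : ∀ q ∈ F, ‖q‖ ≤ M) {x : X} (hT : mtime Ω F x ≠ ∞) {ε : ℝ}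
    (hε : 0 ≤ ε) {p : X →L[ℝ] ℝ} (hp : p ∈ fsub (mtime Ω F) ε x) {η : ℝ} (hη : 0 < η) :
    ∃ z ∈ Ω, ‖z - x‖ ≤ η + M * ((mtime Ω F x).toReal + η) ∧ p ∈ enormal Ω (ε + η) z := by
  obtain ⟨δ, hδ, H⟩ := hp (η / 2) (by positivity)
  set r := (mtime Ω F x).toReal with hr
  obtain ⟨κ, hκ, hκδ, hκη, hκ1⟩ : ∃ κ : ℝ, 0 < κ ∧ κ ≤ δ / 4 ∧ κ ≤ η / 2 ∧ κ ≤ 1 :=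
    ⟨min (δ / 4) (min (η / 2) 1), by positivity, min_le_left _ _,
      (min_le_right _ _).trans (min_le_left _ _), (min_le_right _ _).trans (min_le_right _ _)⟩
  have hTr : mtime Ω F x = ENNReal.ofReal r := (ENNReal.ofReal_toReal hT).symm
  have hr0 : 0 ≤ r := ENNReal.toReal_nonneg
  obtain ⟨t, ht, htr, q, hq, hw⟩ := exists_of_mtime_lt
    (show mtime Ω F x < ENNReal.ofReal (r + κ ^ 2) by
      rw [hTr]
      exact (ENNReal.ofReal_lt_ofReal_iff (by positivity)).2 (by linarith [pow_pos hκ 2]))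
  rw [ENNReal.ofReal_lt_ofReal_iff (by positivity)] at htr
  set w := x + t • q with hw_def
  have hquasi : ∀ u ∈ Ω, ‖u - w‖ < δ → p (u - w) ≤ κ ^ 2 + (ε + η / 2) * ‖u - w‖ := by
    intro u hu huw
    have hshift : u - t • q - x = u - w := by rw [hw_def]; abel
    have h₁ := (H (u - t • q) (by rwa [hshift])).trans
      (mtime_le ht hq (by simpa using hu))
    rw [ENNReal.ofReal_le_ofReal_iff ht, hshift] at h₁
    linarith
  let f : X → ℝ := fun u => -p (u - w) + (ε + η / 2) * ‖u - w‖
  have hf : Continuous f := by fun_prop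
  have hfw : f w = 0 := by simp [f]
  have hball : ∀ u ∈ Metric.closedBall w (δ / 2), ‖u - w‖ < δ := by
    intro u hu
    rw [mem_closedBall_iff_norm] at hu
    linarith
  obtain ⟨z, ⟨hzΩ, hzball⟩, hzw, hzmin⟩ := exists_ekeland_point_s14
    (hΩ.inter (Metric.isClosed_closedBall (x := w) (ε := δ / 2))) hf (m := -κ ^ 2)
    (fun u hu => by have := hquasi u hu.1 (hball u hu.2); simp only [f]; linarith)
    (w := w) ⟨hw, Metric.mem_closedBall_self (by positivity)⟩ hκ
  have hfz := hquasi z hzΩ (hball z hzball)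
  rw [dist_eq_norm, hfw] at hzw
  have hzκ : ‖z - w‖ ≤ κ := by
    refine le_of_mul_le_mul_left (?_ : κ * ‖z - w‖ ≤ κ * κ) hκ
    simp only [f] at hzw
    linarith
  refine ⟨z, hzΩ, ?_, ?_⟩
  · have hwx : ‖w - x‖ ≤ M * (r + η) := by
      rw [hw_def, add_sub_cancel_left, norm_smul, Real.norm_of_nonneg ht, mul_comm]
      have : κ ^ 2 ≤ κ := by nlinarith
      exact mul_le_mul (hM q hq) (by linarith) ht hM0
    have := norm_sub_le_norm_sub_add_norm_sub z w x
    linarith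
  · intro γ hγ
    refine ⟨δ / 4, by positivity, fun u hu huz => ?_⟩
    have huw : u ∈ Metric.closedBall w (δ / 2) := by
      rw [mem_closedBall_iff_norm]
      have := norm_sub_le_norm_sub_add_norm_sub u z w
      linarith
    have h₁ := hzmin u ⟨hu, huw⟩
    rw [dist_eq_norm] at h₁
    have h₂ := mul_le_mul_of_nonneg_left (norm_sub_le_norm_sub_add_norm_sub u z w)
      (by positivity : 0 ≤ ε + η / 2)
    have h₃ : p (u - z) = p (u - w) - p (z - w) := by rw [← map_sub]; congr 1; abel
    have h₄ := mul_le_mul_of_nonneg_right hκη (norm_nonneg (u - z))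
    have h₅ : 0 ≤ γ * ‖u - z‖ := by positivity
    simp only [f] at h₁
    linarith

theorem bsub_mtime_subset [CompleteSpace X] (hΩ : IsClosed Ω) (hFne : F.Nonempty)
    (hFbd : Bornology.IsBounded F) (hFcv : Convex ℝ F) {xb : X} (hxb : xb ∈ Ω) :
    bsub (mtime Ω F) xb ⊆ bnormal Ω xb ∩ {p | suppFn F (-p) ≤ 1} := by
  rintro p ⟨ε, x, ps, hε, hε0, hx, hTx, hps, hlim⟩
  obtain ⟨M, hM0, hM⟩ := hFbd.exists_pos_norm_le
  rw [mtime_eq_zero hFne hxb] at hTx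
  obtain ⟨N, hN⟩ := eventually_atTop.1 (hTx.eventually_lt_const ENNReal.zero_lt_top)
  have hfin : ∀ k, mtime Ω F (x (k + N)) ≠ ∞ := fun k => (hN _ (Nat.le_add_left N k)).ne
  have hshift : Tendsto (fun k : ℕ => k + N) atTop atTop := tendsto_add_atTop_nat N
  have hη : Tendsto (fun k : ℕ => 1 / ((k : ℝ) + 1)) atTop (𝓝 0) :=
    tendsto_one_div_add_atTop_nhds_zero_nat
  refine ⟨?_, suppFn_le hFne fun q hq => ?_⟩
  · have hz : ∀ k : ℕ, _ := fun k => exists_mem_enormal_of_mem_fsub_mtime hΩ hM0.le hM (hfin k)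
      (hε _) (hps (k + N)) (Nat.one_div_pos_of_nat (n := k) (α := ℝ))
    choose z hzΩ hzx hzn using hz
    refine ⟨fun k => ε (k + N) + 1 / ((k : ℝ) + 1), z, fun k => ps (k + N),
      fun k => add_nonneg (hε _) Nat.one_div_pos_of_nat.le, ?_, hzΩ, ?_, hzn,
      fun v => (hlim v).comp hshift⟩
    · simpa using (hε0.comp hshift).add hη
    · have hTr : Tendsto (fun k => (mtime Ω F (x (k + N))).toReal) atTop (𝓝 0) := by
        exact (ENNReal.tendsto_toReal ENNReal.zero_ne_top).comp (hTx.comp hshift)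
      have hzero : Tendsto (fun k => z k - x (k + N)) atTop (𝓝 0) := by
        refine squeeze_zero_norm hzx ?_
        simpa using hη.add ((hTr.add hη).const_mul M)
      simpa using hzero.add (hx.comp hshift)
  · have hbound : Tendsto (fun k => 1 + ε (k + N) * ‖q‖) atTop (𝓝 1) := by
      simpa using ((hε0.comp hshift).mul_const ‖q‖).const_add 1
    exact le_of_tendsto_of_tendsto' ((hlim q).comp hshift).neg hbound
      fun k => neg_apply_le_of_mem_fsub_mtime hFcv (hfin k) (hps _) hq

/-- A pointwise convergent sequence of continuous functionals on a Banach space is bounded. -/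
theorem exists_norm_le_of_tendsto_apply [CompleteSpace X] {ps : ℕ → X →L[ℝ] ℝ} {p : X →L[ℝ] ℝ}
    (hlim : ∀ v, Tendsto (fun k => ps k v) atTop (𝓝 (p v))) : ∃ B, ∀ k, ‖ps k‖ ≤ B := by
  refine banach_steinhaus fun v => ?_
  obtain ⟨C, hC⟩ := (Metric.isBounded_range_of_tendsto _ (hlim v)).exists_norm_le
  exact ⟨C, fun k => hC _ ⟨k, rfl⟩⟩

/-- Weak* limits of approximate normals satisfying the polarity bound, after rescaling by a
convergent sequence of positive factors, are basic subgradients of the minimal time function. -/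
theorem smul_mem_bsub_mtime [CompleteSpace X] (hFne : F.Nonempty)
    (hFbd : Bornology.IsBounded F) {xb : X} (hxb : xb ∈ Ω) {ε : ℕ → ℝ} {x : ℕ → X}
    {ps : ℕ → X →L[ℝ] ℝ} {p : X →L[ℝ] ℝ} (hε : ∀ k, 0 ≤ ε k) (hε0 : Tendsto ε atTop (𝓝 0))
    (hx : ∀ k, x k ∈ Ω) (hxlim : Tendsto x atTop (𝓝 xb))
    (hps : ∀ k, ps k ∈ enormal Ω (ε k) (x k))
    (hlim : ∀ v, Tendsto (fun k => ps k v) atTop (𝓝 (p v)))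
    {c : ℕ → ℝ} {c₀ : ℝ} (hc : ∀ k, 0 < c k) (hclim : Tendsto c atTop (𝓝 c₀))
    (hσ : ∀ k, c k * suppFn F (-ps k) ≤ 1) :
    c₀ • p ∈ bsub (mtime Ω F) xb := by
  obtain ⟨M, hM0, hM⟩ := hFbd.exists_pos_norm_le
  have hlim' : ∀ v, Tendsto (fun k => (c k • ps k) v) atTop (𝓝 ((c₀ • p) v)) :=
    fun v => hclim.mul (hlim v)
  obtain ⟨B, hB⟩ := exists_norm_le_of_tendsto_apply hlim'
  have hB0 : 0 ≤ B := (norm_nonneg _).trans (hB 0)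
  refine ⟨fun k => (1 + M * B) * (c k * ε k), x, fun k => c k • ps k, fun k => ?_, ?_, hxlim, ?_,
    fun k => ?_, hlim'⟩
  · have := hε k
    have := hc k
    positivity
  · simpa using (hclim.mul hε0).const_mul (1 + M * B)
  · simp only [mtime_eq_zero hFne (hx _), mtime_eq_zero hFne hxb]
    exact tendsto_const_nhds
  · refine mem_fsub_mtime_of_mem_enormal hFne hFbd hM0.le hM (hx k)
      (mul_nonneg (hc k).le (hε k)) (hB k) (smul_mem_enormal (hc k) (hps k))
      (suppFn_le hFne fun q hq => ?_)
    have h := mul_le_mul_of_nonneg_left (le_suppFn hFbd (-ps k) hq) (hc k).le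
    have heq : (-(c k • ps k)) q = c k * (-ps k) q := by simp
    rw [heq]
    exact h.trans (hσ k)

end MinimalTime

/-- Theorem 5.2: basic subgradients of minimal time functions and basic
normals to targets at in-set points: `∂T(x̄) ⊆ N(x̄; Ω) ∩ C*`, with equality
under sequential weak* continuity of `σ_F` on `−[N(x̄; Ω) ∩ C*]`, and
`N(x̄; Ω) = ⋃_{λ>0} λ ∂T(x̄)` when additionally `0 ∈ F`. -/
theorem bsub_mtime_inset [NormedAddCommGroup X] [NormedSpace ℝ X]
    [CompleteSpace X]
    (Ω F : Set X) (hΩne : Ω.Nonempty) (hΩcl : IsClosed Ω)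
    (hFne : F.Nonempty) (hFcl : IsClosed F) (hFbd : Bornology.IsBounded F)
    (hFcv : Convex ℝ F)
    (xb : X) (hxb : xb ∈ Ω) :
    (bsub (mtime Ω F) xb ⊆ bnormal Ω xb ∩ {p | suppFn F (-p) ≤ 1}) ∧
    ((∀ p ∈ bnormal Ω xb ∩ {p | suppFn F (-p) ≤ 1},
        ∀ u : ℕ → X →L[ℝ] ℝ,
          (∀ v, Tendsto (fun k => u k v) atTop (𝓝 ((-p) v))) →
          Tendsto (fun k => suppFn F (u k)) atTop (𝓝 (suppFn F (-p)))) →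
      bsub (mtime Ω F) xb = bnormal Ω xb ∩ {p | suppFn F (-p) ≤ 1}) ∧
    (0 ∈ F →
      bnormal Ω xb = ⋃ (l : ℝ) (_ : 0 < l), l • bsub (mtime Ω F) xb) := by
  refine ⟨bsub_mtime_subset hΩcl hFne hFbd hFcv hxb, fun hcont => ?_, fun _ => ?_⟩
  · refine (bsub_mtime_subset hΩcl hFne hFbd hFcv hxb).antisymm fun p hp => ?_
    obtain ⟨⟨ε, x, ps, hε, hε0, hx, hxlim, hps, hlim⟩, hσ⟩ := id hp
    have hσlim := hcont p hp (fun k => -ps k) fun v => (hlim v).neg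
    have hclim : Tendsto (fun k => (max 1 (suppFn F (-ps k)))⁻¹) atTop (𝓝 1) := by
      have h := ((tendsto_const_nhds (x := (1 : ℝ))).max hσlim).inv₀
        (zero_lt_one.trans_le (le_max_left _ _)).ne'
      rwa [max_eq_left (show suppFn F (-p) ≤ 1 from hσ), inv_one] at h
    have hpos : ∀ k, 0 < max 1 (suppFn F (-ps k)) :=
      fun k => zero_lt_one.trans_le (le_max_left _ _)
    have h := smul_mem_bsub_mtime hFne hFbd hxb hε hε0 hx hxlim hps hlim
      (fun k => inv_pos.2 (hpos k)) hclim fun k => by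
        rw [inv_mul_le_iff₀ (hpos k), mul_one]
        exact le_max_right _ _
    rwa [one_smul] at h
  · ext p
    simp only [mem_iUnion, exists_prop]
    constructor
    · rintro ⟨ε, x, ps, hε, hε0, hx, hxlim, hps, hlim⟩
      obtain ⟨M, hM0, hM⟩ := hFbd.exists_pos_norm_le
      obtain ⟨B, hB⟩ := exists_norm_le_of_tendsto_apply hlim
      have hB0 : 0 ≤ B := (norm_nonneg _).trans (hB 0)
      have hl : 0 < B * M + 1 := by positivity
      refine ⟨B * M + 1, hl, (mem_smul_set_iff_inv_smul_mem₀ hl.ne' _ _).2 ?_⟩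
      refine smul_mem_bsub_mtime hFne hFbd hxb hε hε0 hx hxlim hps hlim
        (fun _ => inv_pos.2 hl) tendsto_const_nhds fun k => ?_
      rw [inv_mul_le_iff₀ hl, mul_one]
      refine suppFn_le hFne fun q hq => ?_
      have h₁ : (-ps k) q ≤ B * ‖q‖ :=
        (le_abs_self _).trans ((-ps k).le_of_opNorm_le (by rw [norm_neg]; exact hB k) q)
      have h₂ := mul_le_mul_of_nonneg_left (hM q hq) hB0
      linarith
    · rintro ⟨l, hl, p, hp, rfl⟩
      exact smul_mem_bnormal hl (bsub_mtime_subset hΩcl hFne hFbd hFcv hxb hp).1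
end
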